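/- arXiv:2403.14826 — 4 statements merged into one kernel-verified Lean document; each statement's English description precedes it below -/
import Mathlib

section
/- Let (𝒳, ℬ) be a measurable space, let π and μ be probability measures on it, and let H, f, G : 𝒳 → [1,∞) be measurable functions with f(x)·G(x) = H(x) for all x ∈ 𝒳 and with f integrable with respect to π. Assume: (a) a : [1,∞) → (0,1] is continuous, the function A(r) := r·a(r) is strictly increasing with A(r) → ∞ as r → ∞, and ∫_{{G ≥ r}} f dπ ≥ a(r) for all r ∈ [1,∞); (b) v ∈ [1,∞) satisfies ∫ H dμ ≤ v. Then ‖π − μ‖_f ≥ a(r*)/2, where r* is the unique r ∈ [1,∞) with A(r) = 2v. -/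
open MeasureTheory Filter Set

noncomputable section

/-- The `f`-variation distance between two measures: the supremum of
`|∫ g dπ − ∫ g dμ|` over measurable `g` with `|g| ≤ f` which are integrable with
respect to both measures. -/
def fVarDist {𝒳 : Type*} [MeasurableSpace 𝒳] (π μ : Measure 𝒳) (f : 𝒳 → ℝ) : ℝ :=
  sSup {d : ℝ | ∃ g : 𝒳 → ℝ, Measurable g ∧ (∀ x, |g x| ≤ f x) ∧
    Integrable g π ∧ Integrable g μ ∧ d = |∫ x, g x ∂π - ∫ x, g x ∂μ|}

theorem stmt_3
    {𝒳 : Type*} [MeasurableSpace 𝒳]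
    (π μ : Measure 𝒳) [IsProbabilityMeasure π] [IsProbabilityMeasure μ]
    (H f G : 𝒳 → ℝ)
    (hHmeas : Measurable H) (hfmeas : Measurable f) (hGmeas : Measurable G)
    (hH1 : ∀ x, 1 ≤ H x) (hf1 : ∀ x, 1 ≤ f x) (hG1 : ∀ x, 1 ≤ G x)
    (hfG : ∀ x, f x * G x = H x)
    (hfint : Integrable f π)
    (a : ℝ → ℝ)
    (hacont : ContinuousOn a (Set.Ici 1))
    (harange : ∀ r : ℝ, 1 ≤ r → a r ∈ Set.Ioc (0:ℝ) 1)
    (hAmono : StrictMonoOn (fun r => r * a r) (Set.Ici 1))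
    (hAtop : Tendsto (fun r => r * a r) atTop atTop)
    (hlower : ∀ r : ℝ, 1 ≤ r → a r ≤ ∫ x in {x | r ≤ G x}, f x ∂π)
    (v : ℝ) (hv : 1 ≤ v)
    (hHμ : ∫⁻ x, ENNReal.ofReal (H x) ∂μ ≤ ENNReal.ofReal v)
    (rstar : ℝ) (hrstar1 : 1 ≤ rstar) (hrstar : rstar * a rstar = 2 * v) :
    a rstar / 2 ≤ fVarDist π μ f := by
  have hr0 : 0 < rstar := by linarith
  have hHint : Integrable H μ := by
    refine ⟨hHmeas.aestronglyMeasurable, ?_⟩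
    rw [hasFiniteIntegral_iff_ofReal (ae_of_all _ fun x => by
      show (0:ℝ) ≤ H x
      linarith [hH1 x])]
    exact lt_of_le_of_lt hHμ ENNReal.ofReal_lt_top
  have hHle : ∫ x, H x ∂μ ≤ v := by
    rw [integral_eq_lintegral_of_nonneg_ae (ae_of_all _ fun x => by
      show (0:ℝ) ≤ H x
      linarith [hH1 x]) hHmeas.aestronglyMeasurable]
    exact ENNReal.toReal_le_of_le_ofReal (by linarith) hHμ
  have hfμ : Integrable f μ := by
    refine hHint.mono' hfmeas.aestronglyMeasurable (ae_of_all _ fun x => ?_)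
    rw [Real.norm_eq_abs, abs_of_nonneg (by linarith [hf1 x])]
    nlinarith [hf1 x, hG1 x, hfG x]
  have hS : MeasurableSet {x | rstar ≤ G x} := measurableSet_le measurable_const hGmeas
  have hgμ : ∫ x, ({x | rstar ≤ G x}.indicator f) x ∂μ ≤ a rstar / 2 := by
    have h1 : ∫ x, ({x | rstar ≤ G x}.indicator f) x ∂μ ≤ ∫ x, H x / rstar ∂μ := by
      refine integral_mono (hfμ.indicator hS) (hHint.div_const _) fun x => ?_
      show ({x | rstar ≤ G x}.indicator f) x ≤ H x / rstar
      by_cases hx : rstar ≤ G x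
      · rw [indicator_of_mem (show x ∈ {x | rstar ≤ G x} from hx), le_div_iff₀ hr0, ← hfG x]
        exact mul_le_mul_of_nonneg_left hx (by linarith [hf1 x])
      · rw [indicator_of_notMem (show x ∉ {x | rstar ≤ G x} from hx)]
        exact div_nonneg (by linarith [hH1 x]) hr0.le
    rw [integral_div] at h1
    refine h1.trans ?_
    rw [div_le_iff₀ hr0]
    linarith
  have hgπ : a rstar ≤ ∫ x, ({x | rstar ≤ G x}.indicator f) x ∂π := by
    rw [integral_indicator hS]
    exact hlower rstar hrstar1
  have hbdd : BddAbove {d : ℝ | ∃ g : 𝒳 → ℝ, Measurable g ∧ (∀ x, |g x| ≤ f x) ∧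
      Integrable g π ∧ Integrable g μ ∧ d = |∫ x, g x ∂π - ∫ x, g x ∂μ|} := by
    refine ⟨∫ x, f x ∂π + ∫ x, f x ∂μ, ?_⟩
    rintro d ⟨g, -, hgf, -, -, rfl⟩
    have h1 : |∫ x, g x ∂π| ≤ ∫ x, f x ∂π := by
      rw [← Real.norm_eq_abs]
      exact norm_integral_le_of_norm_le hfint (ae_of_all _ hgf)
    have h2 : |∫ x, g x ∂μ| ≤ ∫ x, f x ∂μ := by
      rw [← Real.norm_eq_abs]
      exact norm_integral_le_of_norm_le hfμ (ae_of_all _ hgf)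
    exact (abs_sub _ _).trans (add_le_add h1 h2)
  refine le_trans ?_ (le_csSup hbdd ⟨{x | rstar ≤ G x}.indicator f, hfmeas.indicator hS,
    fun x => ?_, hfint.indicator hS, hfμ.indicator hS, rfl⟩)
  · exact le_trans (by linarith) (le_abs_self _)
  · by_cases hx : rstar ≤ G x
    · rw [indicator_of_mem (show x ∈ {x | rstar ≤ G x} from hx),
        abs_of_nonneg (by linarith [hf1 x])]
    · rw [indicator_of_notMem (show x ∉ {x | rstar ≤ G x} from hx), abs_zero]
      linarith [hf1 x]
end
end

section
/- Let μ ∈ (0,∞), let σ : ℝ → [0,∞) be Lipschitz with 0 < inf_x σ(x) ≤ sup_x σ(x) < ∞, and let ν be a Lévy measure on ℝ satisfying Assumption A_L. Fix m ∈ [1, m_c) and let g_m : ℝ → [1,∞) be twice continuously differentiable and nondecreasing, with g_m(x) = 1 for all x ≤ 1, g_m(x) = (log x)^m for all x ≥ x_m for some x_m ≥ e, and with g_m' and g_m'' bounded on ℝ. Then there exists C₁ ∈ (0,∞) such that for every x ∈ ℝ the positive part of the integrand in the definition of 𝒜g_m(x) is ν-integrable (so 𝒜g_m(x) is well defined in [−∞,∞))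 and 𝒜g_m(x) ≤ C₁. -/
open MeasureTheory Filter Set
open scoped ENNReal

noncomputable section

lemma aux_exp_pow {p u v : ℝ} (hp : 0 ≤ p) (hu : 1 ≤ u) (hpu : p ≤ u) (huv : u ≤ v) :
    v ^ p * Real.exp (-v) ≤ u ^ p * Real.exp (-u) := by
  have hu0 : 0 < u := by linarith
  have hv0 : 0 < v := by linarith
  rw [Real.rpow_def_of_pos hu0, Real.rpow_def_of_pos hv0, ← Real.exp_add, ← Real.exp_add,
    Real.exp_le_exp]
  have h1 : Real.log v - Real.log u ≤ v / u - 1 := by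
    rw [← Real.log_div hv0.ne' hu0.ne']
    exact Real.log_le_sub_one_of_pos (by positivity)
  have h2 : (Real.log v - Real.log u) * p ≤ (v / u - 1) * p :=
    mul_le_mul_of_nonneg_right h1 hp
  have h3 : (v / u - 1) * p ≤ (v / u - 1) * u := by
    apply mul_le_mul_of_nonneg_left hpu
    rw [sub_nonneg, le_div_iff₀ hu0]; linarith
  have h4 : (v / u - 1) * u = v - u := by field_simp
  linarith

lemma aux_deriv {m x_m z : ℝ} {g : ℝ → ℝ} (hx_m : Real.exp 1 ≤ x_m)
    (hgtail : ∀ x : ℝ, x_m ≤ x → g x = Real.log x ^ m) (hz : x_m < z) :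
    deriv g z = m * (Real.log z ^ (m - 1) * Real.exp (-Real.log z)) := by
  have hz0 : 0 < z := lt_trans (lt_of_lt_of_le (Real.exp_pos 1) hx_m) hz
  have hl : 1 < Real.log z := by
    rw [Real.lt_log_iff_exp_lt hz0]; linarith
  have he : g =ᶠ[nhds z] fun x => Real.log x ^ m := by
    filter_upwards [lt_mem_nhds hz] with x hx using hgtail x hx.le
  rw [he.deriv_eq]
  have h := (Real.hasDerivAt_log hz0.ne').rpow_const (p := m) (Or.inl (by linarith))
  rw [h.deriv, Real.exp_neg, Real.exp_log hz0]
  ring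

lemma aux_sub {m x_m : ℝ} (hm : 1 ≤ m) {g : ℝ → ℝ} (hg : ContDiff ℝ 2 g) (hgmono : Monotone g)
    (hg1 : ∀ x, 1 ≤ g x) (hx_m : Real.exp 1 ≤ x_m)
    (hgtail : ∀ x : ℝ, x_m ≤ x → g x = Real.log x ^ m) (x a : ℝ) (ha : 0 ≤ a) :
    g (x + a) - g x ≤ g (max x_m (Real.exp m) + a) := by
  set X := max x_m (Real.exp m) with hX
  have hgd : Differentiable ℝ g := hg.differentiable (by norm_num)
  rcases le_total x X with h | h
  · have := hgmono (show x + a ≤ X + a by linarith)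
    have := hg1 x
    linarith
  · have hanti : AntitoneOn (fun z => g (z + a) - g z) (Ici X) := by
      apply antitoneOn_of_deriv_nonpos (convex_Ici X)
      · apply Continuous.continuousOn
        have := hgd.continuous
        fun_prop
      · apply Differentiable.differentiableOn
        fun_prop
      · intro z hz
        rw [interior_Ici] at hz
        have hz' : X < z := hz
        have hzx : x_m < z := lt_of_le_of_lt (le_max_left _ _) hz'
        have hzm : Real.exp m < z := lt_of_le_of_lt (le_max_right _ _) hz'
        have hz0 : 0 < z := lt_trans (Real.exp_pos m) hzm
        have hd : HasDerivAt (fun z => g (z + a) - g z) (deriv g (z + a) - deriv g z) z :=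
          ((hgd (z + a)).hasDerivAt.comp_add_const z a).sub (hgd z).hasDerivAt
        rw [hd.deriv, aux_deriv hx_m hgtail hzx, aux_deriv hx_m hgtail (by linarith : x_m < z + a)]
        have hlm : m < Real.log z := by rwa [Real.lt_log_iff_exp_lt hz0]
        have := aux_exp_pow (p := m - 1) (by linarith) (by linarith : 1 ≤ Real.log z)
          (by linarith) (Real.log_le_log hz0 (by linarith : z ≤ z + a))
        have := mul_le_mul_of_nonneg_left this (by linarith : 0 ≤ m)
        linarith
    have := hanti (mem_Ici.2 le_rfl) (mem_Ici.2 h) h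
    simp only at this
    have := hg1 X
    linarith

lemma aux_taylor {g : ℝ → ℝ} (hg : ContDiff ℝ 2 g) {K : ℝ}
    (hK : ∀ x : ℝ, |deriv (deriv g) x| ≤ K) (x h : ℝ) :
    g (x + h) - g x - deriv g x * h ≤ K * h ^ 2 := by
  have hgd : Differentiable ℝ g := hg.differentiable (by norm_num)
  have hg' : Differentiable ℝ (deriv g) := by
    have : ContDiff ℝ 1 (deriv g) := ((contDiff_succ_iff_deriv (n := 1)).1 hg).2.2
    exact this.differentiable (by norm_num)
  have hK0 : 0 ≤ K := (abs_nonneg _).trans (hK 0)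
  have hlip : ∀ z, |deriv g z - deriv g x| ≤ K * |z - x| := fun z =>
    Convex.norm_image_sub_le_of_norm_deriv_le (s := univ) (fun z _ => hg' z)
      (fun z _ => hK z) convex_univ (mem_univ x) (mem_univ z)
  have hd : ∀ z, HasDerivAt (fun z => g z - deriv g x * z) (deriv g z - deriv g x) z := by
    intro z
    have := (hgd z).hasDerivAt.sub ((hasDerivAt_id z).const_mul (deriv g x))
    rw [mul_one] at this
    exact this
  have key := Convex.norm_image_sub_le_of_norm_hasDerivWithin_le (s := Metric.closedBall x |h|)
      (f := fun z => g z - deriv g x * z) (f' := fun z => deriv g z - deriv g x) (C := K * |h|)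
      (fun z _ => (hd z).hasDerivWithinAt)
      (fun z hz => (hlip z).trans (by
        have : |z - x| ≤ |h| := hz
        gcongr))
      (convex_closedBall x |h|) (x := x) (y := x + h) (by simp) (by simp [Real.dist_eq])
  simp only [Real.norm_eq_abs, add_sub_cancel_left] at key
  have h2 := (le_abs_self _).trans key
  have : |h| * |h| = h ^ 2 := by rw [← sq, sq_abs]
  nlinarith

lemma aux_int {ν : Measure ℝ} {m_c m cl cu R R' : ℝ} (hm : 1 ≤ m) (hmlt : m < m_c)
    (hcl : 0 < cl) (hR : ∀ r : ℝ, R ≤ r →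
      cl ≤ Real.log r ^ m_c * (ν (Set.Ici r)).toReal ∧
        Real.log r ^ m_c * (ν (Set.Ici r)).toReal ≤ cu)
    (hRR : R ≤ R') (hR' : Real.exp 1 ≤ R') :
    ∫⁻ y in Ici R', ENNReal.ofReal (Real.log y ^ m) ∂ν < ⊤ := by
  have hfin : ∀ r, R ≤ r → ν (Ici r) ≠ ⊤ := by
    intro r hr h
    have := (hR r hr).1
    rw [h] at this
    simp at this
    linarith
  have hR0 : 0 < R' := (Real.exp_pos 1).trans_le hR'
  set T := Real.log R' with hT
  have hT1 : 1 ≤ T := by rw [hT, Real.le_log_iff_exp_le hR0]; exact hR'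
  rw [lintegral_rpow_eq_lintegral_meas_le_mul (ν.restrict (Ici R')) _
    (Real.measurable_log.aemeasurable) (by linarith : 0 < m)]
  swap
  · refine (ae_restrict_iff' measurableSet_Ici).2 (ae_of_all _ fun y hy => ?_)
    have : R' ≤ y := hy
    exact Real.log_nonneg (by linarith [Real.add_one_le_exp (1:ℝ)])
  apply ENNReal.mul_lt_top ENNReal.ofReal_lt_top
  rw [← Ioc_union_Ioi_eq_Ioi (by linarith : (0:ℝ) ≤ T)]
  refine (lintegral_union_le _ _ _).trans_lt (ENNReal.add_lt_top.2 ⟨?_, ?_⟩)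
  · calc _ ≤ ∫⁻ t in Ioc 0 T, ν (Ici R') * ENNReal.ofReal (T ^ (m - 1)) := by
          refine setLIntegral_mono' measurableSet_Ioc fun t ht => ?_
          refine mul_le_mul' ?_ (ENNReal.ofReal_le_ofReal
            (Real.rpow_le_rpow ht.1.le ht.2 (by linarith)))
          refine (measure_mono (subset_univ _)).trans ?_
          rw [Measure.restrict_apply_univ]
      _ < ⊤ := by
          rw [setLIntegral_const]
          refine ENNReal.mul_lt_top (ENNReal.mul_lt_top (hfin R' hRR).lt_top
            ENNReal.ofReal_lt_top) (by simp)
  · have hi : IntegrableOn (fun t : ℝ => cu * t ^ (m - 1 - m_c)) (Ioi T) :=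
      (integrableOn_Ioi_rpow_of_lt (by linarith) (by linarith)).const_mul cu
    refine lt_of_le_of_lt ?_ hi.lintegral_lt_top
    refine setLIntegral_mono' measurableSet_Ioi fun t ht => ?_
    have htT : T < t := ht
    have ht0 : 0 < t := by linarith
    have hRt : R' ≤ Real.exp t := by
      rw [← Real.log_le_iff_le_exp hR0]; exact htT.le
    have h1 : (ν.restrict (Ici R')) {a | t ≤ Real.log a} ≤ ν (Ici (Real.exp t)) := by
      rw [Measure.restrict_apply (measurableSet_le measurable_const Real.measurable_log)]
      apply measure_mono
      rintro a ⟨ha, ha'⟩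
      have : R' ≤ a := ha'
      exact (Real.le_log_iff_exp_le (by linarith)).1 ha
    have h2 := (hR (Real.exp t) (hRR.trans hRt)).2
    rw [Real.log_exp] at h2
    have h3 : (ν (Ici (Real.exp t))).toReal ≤ cu * t ^ (-m_c) := by
      rw [Real.rpow_neg ht0.le, ← div_eq_mul_inv, le_div_iff₀ (by positivity)]
      linarith
    calc _ ≤ ENNReal.ofReal (cu * t ^ (-m_c)) * ENNReal.ofReal (t ^ (m - 1)) := by
          gcongr
          refine h1.trans ?_
          exact ENNReal.le_ofReal_iff_toReal_le (hfin _ (hRR.trans hRt))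
            (ENNReal.toReal_nonneg.trans h3) |>.2 h3
      _ = _ := by
          rw [← ENNReal.ofReal_mul (ENNReal.toReal_nonneg.trans h3), mul_assoc,
            ← Real.rpow_add ht0]
          congr 3
          ring

theorem stmt_14
    (μc : ℝ) (hμc : 0 < μc)
    (σ : ℝ → ℝ) (hσlip : ∃ K : NNReal, LipschitzWith K σ)
    (hσpos : ∃ ε : ℝ, 0 < ε ∧ ∀ x, ε ≤ σ x)
    (hσbdd : ∃ M : ℝ, ∀ x, σ x ≤ M)
    (ν : Measure ℝ)
    (hν0 : ν {(0:ℝ)} = 0)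
    (hνlevy : ∫⁻ y : ℝ, ENNReal.ofReal (min 1 (y ^ 2)) ∂ν < ⊤)
    (m_c : ℝ) (hm_c : 1 < m_c)
    (hνpos : ∃ cl cu R : ℝ, 0 < cl ∧ 1 < R ∧ ∀ r : ℝ, R ≤ r →
      cl ≤ Real.log r ^ m_c * (ν (Set.Ici r)).toReal ∧
        Real.log r ^ m_c * (ν (Set.Ici r)).toReal ≤ cu)
    (hνneg : Tendsto (fun r : ℝ => (ν (Set.Iic r)).toReal * Real.log |r| ^ (m_c + 1))
      atBot (nhds 0))
    (m : ℝ) (hm : 1 ≤ m) (hmlt : m < m_c)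
    (g : ℝ → ℝ) (hg : ContDiff ℝ 2 g) (hgmono : Monotone g) (hg1 : ∀ x, 1 ≤ g x)
    (hgleft : ∀ x : ℝ, x ≤ 1 → g x = 1)
    (x_m : ℝ) (hx_m : Real.exp 1 ≤ x_m)
    (hgtail : ∀ x : ℝ, x_m ≤ x → g x = Real.log x ^ m)
    (hgbdd : ∃ K : ℝ, ∀ x : ℝ, |deriv g x| ≤ K ∧ |deriv (deriv g) x| ≤ K) :
    ∃ C₁ : ℝ, 0 < C₁ ∧ ∀ x : ℝ,
      (∫⁻ y : ℝ, ENNReal.ofReal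
          (g (x + σ x * y) - g x
            - deriv g x * σ x * Set.indicator (Set.Icc (-1:ℝ) 1) id y) ∂ν) ≠ ⊤ ∧
      ((↑(-(μc * x * deriv g x)) : EReal)
        + (↑(∫⁻ y : ℝ, ENNReal.ofReal
            (g (x + σ x * y) - g x
              - deriv g x * σ x * Set.indicator (Set.Icc (-1:ℝ) 1) id y) ∂ν) : EReal)
        - (↑(∫⁻ y : ℝ, ENNReal.ofReal
            (-(g (x + σ x * y) - g x
              - deriv g x * σ x * Set.indicator (Set.Icc (-1:ℝ) 1) id y)) ∂ν) : EReal)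
        ≤ (↑C₁ : EReal)) := by
  obtain ⟨cl, cu, R, hcl, hR1, hR⟩ := hνpos
  obtain ⟨ε, hε, hσε⟩ := hσpos
  obtain ⟨M, hM⟩ := hσbdd
  obtain ⟨K, hK⟩ := hgbdd
  have hM0 : 0 < M := hε.trans_le ((hσε 0).trans (hM 0))
  have hK0 : 0 ≤ K := (abs_nonneg _).trans (hK 0).1
  set X := max x_m (Real.exp m) with hX
  have hX0 : 0 < X := lt_max_of_lt_right (Real.exp_pos m)
  set R' := max R (max (Real.exp 1) (max (X + M) x_m)) with hR'
  have hRR : R ≤ R' := le_max_left _ _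
  have hRe : Real.exp 1 ≤ R' := (le_max_left _ _).trans (le_max_right _ _)
  have hRX : X + M ≤ R' :=
    (le_max_left _ _).trans ((le_max_right _ _).trans (le_max_right _ _))
  have hRx : x_m ≤ R' :=
    (le_max_right _ _).trans ((le_max_right _ _).trans (le_max_right _ _))
  set A := max (K * M ^ 2) (g (X + M * R')) with hA
  have hA0 : 0 ≤ A := le_max_of_le_right (zero_le_one.trans (hg1 _))
  set D : ℝ≥0∞ := ∫⁻ y, (ENNReal.ofReal A * ENNReal.ofReal (min 1 (y ^ 2)) +
    (Ici R').indicator (fun y => ENNReal.ofReal (2 ^ m) * ENNReal.ofReal (Real.log y ^ m)) y) ∂ν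
    with hD
  have hDtop : D < ⊤ := by
    rw [hD, lintegral_add_left (by fun_prop), lintegral_const_mul _ (by fun_prop),
      lintegral_indicator measurableSet_Ici,
      lintegral_const_mul _ (by fun_prop)]
    exact ENNReal.add_lt_top.2 ⟨ENNReal.mul_lt_top ENNReal.ofReal_lt_top hνlevy,
      ENNReal.mul_lt_top ENNReal.ofReal_lt_top (aux_int hm hmlt hcl hR hRR hRe)⟩
  have hbound : ∀ x : ℝ, (∫⁻ y : ℝ, ENNReal.ofReal
          (g (x + σ x * y) - g x
            - deriv g x * σ x * Set.indicator (Set.Icc (-1:ℝ) 1) id y) ∂ν) ≤ D := by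
    intro x
    refine lintegral_mono fun y => ?_
    have hσ0 : 0 < σ x := hε.trans_le (hσε x)
    by_cases hy : y ∈ Icc (-1:ℝ) 1
    · refine le_trans ?_ le_self_add
      rw [← ENNReal.ofReal_mul hA0]
      apply ENNReal.ofReal_le_ofReal
      rw [indicator_of_mem hy, id]
      have hy2 : y ^ 2 ≤ 1 := by nlinarith [hy.1, hy.2]
      rw [min_eq_right hy2]
      have h1 := aux_taylor hg (fun x => (hK x).2) x (σ x * y)
      have h2 : K * (σ x * y) ^ 2 ≤ K * M ^ 2 * y ^ 2 := by
        rw [mul_pow, ← mul_assoc]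
        gcongr
        exact hM x
      have h3 : K * M ^ 2 * y ^ 2 ≤ A * y ^ 2 := by
        gcongr
        exact le_max_left _ _
      linarith
    · rw [indicator_of_notMem hy, mul_zero, sub_zero]
      by_cases hy1 : y < -1
      · rw [ENNReal.ofReal_of_nonpos]
        · exact zero_le
        · have := hgmono (show x + σ x * y ≤ x by nlinarith)
          linarith
      · have hy' : 1 < y := by
          by_contra h
          exact hy ⟨by linarith, by linarith⟩
        have h0 : g (x + σ x * y) ≤ g (x + M * y) := by
          apply hgmono
          have := hM x
          gcongr
        have h1 := aux_sub hm hg hgmono hg1 hx_m hgtail x (M * y) (by positivity)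
        rw [← hX] at h1
        by_cases hyR : R' ≤ y
        · refine le_trans ?_ le_add_self
          rw [indicator_of_mem (mem_Ici.2 hyR), ← ENNReal.ofReal_mul (by positivity)]
          apply ENNReal.ofReal_le_ofReal
          have h2 : g (X + M * y) ≤ g (y ^ 2) := by
            apply hgmono
            nlinarith
          rw [hgtail (y ^ 2) (by nlinarith), Real.log_pow, Nat.cast_ofNat,
            Real.mul_rpow (by norm_num) (Real.log_nonneg hy'.le)] at h2
          linarith
        · refine le_trans ?_ le_self_add
          have hm1 : min 1 (y ^ 2) = 1 := min_eq_left (by nlinarith)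
          rw [hm1, ENNReal.ofReal_one, mul_one]
          apply ENNReal.ofReal_le_ofReal
          have h2 : g (X + M * y) ≤ g (X + M * R') := by
            apply hgmono
            have := (not_le.1 hyR).le
            gcongr
          have h3 : g (X + M * R') ≤ A := le_max_right _ _
          linarith
  refine ⟨D.toReal + 1, by positivity, fun x => ⟨((hbound x).trans_lt hDtop).ne, ?_⟩⟩
  have hdrift : -(μc * x * deriv g x) ≤ 0 := by
    rcases lt_or_ge x 1 with h | h
    · have he : g =ᶠ[nhds x] fun _ => (1:ℝ) := by
        filter_upwards [gt_mem_nhds h] with z hz using hgleft z hz.le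
      rw [he.deriv_eq]; simp
    · have : 0 ≤ deriv g x := hgmono.deriv_nonneg
      have : 0 ≤ μc * x * deriv g x := by positivity
      linarith
  have hb := hbound x
  generalize (∫⁻ y : ℝ, ENNReal.ofReal
          (g (x + σ x * y) - g x
            - deriv g x * σ x * Set.indicator (Set.Icc (-1:ℝ) 1) id y) ∂ν) = I at hb
  generalize (∫⁻ y : ℝ, ENNReal.ofReal
          (-(g (x + σ x * y) - g x
            - deriv g x * σ x * Set.indicator (Set.Icc (-1:ℝ) 1) id y)) ∂ν) = J
  have h1 : ((-(μc * x * deriv g x) : ℝ) : EReal) ≤ 0 := by exact_mod_cast hdrift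
  have h2 : (I : EReal) ≤ ((D.toReal + 1 : ℝ) : EReal) := by
    have h3 : (I : EReal) ≤ (D : EReal) := by exact_mod_cast hb
    refine h3.trans ?_
    rw [← ENNReal.ofReal_toReal hDtop.ne, EReal.coe_ennreal_ofReal, max_eq_left ENNReal.toReal_nonneg]
    exact_mod_cast (by rw [ENNReal.toReal_ofReal ENNReal.toReal_nonneg]; linarith)
  calc _ ≤ (0 : EReal) + ((D.toReal + 1 : ℝ) : EReal) - 0 := by
        apply EReal.sub_le_sub (add_le_add h1 h2)
        exact EReal.coe_ennreal_nonneg J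
    _ = _ := by simp
end
end

section
/- Let μ ∈ (0,∞), let σ : ℝ → [0,∞) be Lipschitz with 0 < inf_x σ(x) ≤ sup_x σ(x) < ∞, and let ν be a Lévy measure on ℝ satisfying Assumption A_L. Let g₁ : ℝ → [1,∞) be twice continuously differentiable and nondecreasing, with g₁(x) = 1 for all x ≤ 1, g₁(x) = log x for all x ≥ x₁ for some x₁ ≥ e, and with g₁' and g₁'' bounded on ℝ. Then there exist constants C₂, b, ℓ₀ ∈ (0,∞) such that for every x ∈ ℝ the integral in the definition of 𝒜(1/g₁)(x) is absolutely convergent and 𝒜(1/g₁)(x) ≤ C₂/g₁(x)² + b·1{g₁(x) ≤ ℓ₀}. -/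
open MeasureTheory Filter Set
open scoped ENNReal

noncomputable section

set_option maxHeartbeats 1000000

/-- Second order Taylor estimate. -/
theorem taylor_aux (f f1 f2 : ℝ → ℝ) (hf : ∀ z, HasDerivAt f (f1 z) z)
    (hf1 : ∀ z, HasDerivAt f1 (f2 z) z) (x h D : ℝ)
    (hD : ∀ z ∈ uIcc x (x + h), |f2 z| ≤ D) :
    |f (x + h) - f x - f1 x * h| ≤ D * h ^ 2 := by
  have hD0 : 0 ≤ D := (abs_nonneg _).trans (hD x left_mem_uIcc)
  have h1 : ∀ z ∈ uIcc x (x + h), ‖f1 z - f1 x‖ ≤ D * |h| := by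
    intro z hz
    have := (convex_uIcc x (x + h)).norm_image_sub_le_of_norm_hasDerivWithin_le
      (f := f1) (f' := f2) (C := D) (fun w _ => (hf1 w).hasDerivWithinAt)
      (fun w hw => hD w hw) left_mem_uIcc hz
    refine this.trans (mul_le_mul_of_nonneg_left ?_ hD0)
    have := abs_sub_left_of_mem_uIcc hz
    simpa using this
  have h2 := (convex_uIcc x (x + h)).norm_image_sub_le_of_norm_hasDerivWithin_le
      (f := fun z => f z - f1 x * z) (f' := fun z => f1 z - f1 x) (C := D * |h|)
      (fun w _ => by
        have := (hf w).sub ((hasDerivAt_id w).const_mul (f1 x))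
        rw [mul_one] at this
        exact this.hasDerivWithinAt)
      h1 left_mem_uIcc right_mem_uIcc
  rw [Real.norm_eq_abs, Real.norm_eq_abs] at h2
  have e1 : f (x + h) - f1 x * (x + h) - (f x - f1 x * x) = f (x + h) - f x - f1 x * h := by ring
  rw [e1, add_sub_cancel_left, mul_assoc, abs_mul_abs_self] at h2
  rw [pow_two]; exact h2

/-- Elementary bound on `1/log`. -/
theorem inv_log_aux (x : ℝ) (hx : 4 ≤ x) :
    (Real.log (x / 2))⁻¹ - (Real.log x)⁻¹ ≤ 2 / Real.log x ^ 2 := by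
  have hl2 : 0 < Real.log 2 := Real.log_pos (by norm_num)
  have hlle : Real.log 2 ≤ 1 := by linarith [Real.log_two_lt_d9]
  have h4 : 2 * Real.log 2 ≤ Real.log x := by
    have : Real.log 4 = 2 * Real.log 2 := by
      rw [show (4:ℝ) = 2 ^ 2 by norm_num, Real.log_pow]; norm_num
    rw [← this]; exact Real.log_le_log (by norm_num) hx
  rw [Real.log_div (by linarith) (by norm_num)]
  set L := Real.log x
  have hL : 0 < L := by linarith
  have hL2 : 0 < L - Real.log 2 := by linarith
  rw [inv_sub_inv hL2.ne' hL.ne', div_le_div_iff₀ (by positivity) (by positivity)]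
  nlinarith [mul_pos hL hL, mul_pos hL hL2]

theorem stmt_15
    (μc : ℝ) (hμc : 0 < μc)
    (σ : ℝ → ℝ) (hσlip : ∃ K : NNReal, LipschitzWith K σ)
    (hσpos : ∃ ε : ℝ, 0 < ε ∧ ∀ x, ε ≤ σ x)
    (hσbdd : ∃ M : ℝ, ∀ x, σ x ≤ M)
    (ν : Measure ℝ)
    (hν0 : ν {(0:ℝ)} = 0)
    (hνlevy : ∫⁻ y : ℝ, ENNReal.ofReal (min 1 (y ^ 2)) ∂ν < ⊤)
    (m_c : ℝ) (hm_c : 1 < m_c)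
    (hνpos : ∃ cl cu R : ℝ, 0 < cl ∧ 1 < R ∧ ∀ r : ℝ, R ≤ r →
      cl ≤ Real.log r ^ m_c * (ν (Set.Ici r)).toReal ∧
        Real.log r ^ m_c * (ν (Set.Ici r)).toReal ≤ cu)
    (hνneg : Tendsto (fun r : ℝ => (ν (Set.Iic r)).toReal * Real.log |r| ^ (m_c + 1))
      atBot (nhds 0))
    (g : ℝ → ℝ) (hg : ContDiff ℝ 2 g) (hgmono : Monotone g) (hg1 : ∀ x, 1 ≤ g x)
    (hgleft : ∀ x : ℝ, x ≤ 1 → g x = 1)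
    (x₁ : ℝ) (hx₁ : Real.exp 1 ≤ x₁)
    (hgtail : ∀ x : ℝ, x₁ ≤ x → g x = Real.log x)
    (hgbdd : ∃ K : ℝ, ∀ x : ℝ, |deriv g x| ≤ K ∧ |deriv (deriv g) x| ≤ K) :
    ∃ C₂ b ℓ₀ : ℝ, 0 < C₂ ∧ 0 < b ∧ 0 < ℓ₀ ∧ ∀ x : ℝ,
      Integrable (fun y : ℝ =>
        (g (x + σ x * y))⁻¹ - (g x)⁻¹
          - deriv (fun z => (g z)⁻¹) x * σ x * Set.indicator (Set.Icc (-1:ℝ) 1) id y) ν ∧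
      -(μc * x * deriv (fun z => (g z)⁻¹) x)
        + (∫ y : ℝ,
            ((g (x + σ x * y))⁻¹ - (g x)⁻¹
              - deriv (fun z => (g z)⁻¹) x * σ x * Set.indicator (Set.Icc (-1:ℝ) 1) id y) ∂ν)
        ≤ C₂ / g x ^ 2 + b * (if g x ≤ ℓ₀ then 1 else 0) := by
  obtain ⟨ε, hε, hσε⟩ := hσpos
  obtain ⟨M, hM⟩ := hσbdd
  obtain ⟨K, hK⟩ := hgbdd
  have hMpos : 0 < M := hε.trans_le ((hσε 0).trans (hM 0))
  have hσ0 : ∀ x, 0 < σ x := fun x => hε.trans_le (hσε x)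
  have hK0 : 0 ≤ K := (abs_nonneg _).trans (hK 0).1
  have hgpos : ∀ x, 0 < g x := fun x => zero_lt_one.trans_le (hg1 x)
  -- derivatives
  have hgd : ∀ z, HasDerivAt g (deriv g z) z := fun z =>
    (hg.differentiable (by norm_num) z).hasDerivAt
  have hgdd : ∀ z, HasDerivAt (deriv g) (deriv (deriv g) z) z := by
    have h2 : ContDiff ℝ (1 + 1) g := by simpa [one_add_one_eq_two] using hg
    have := (contDiff_succ_iff_deriv.1 h2).2.2
    exact fun z => (this.differentiable (by norm_num) z).hasDerivAt
  set f : ℝ → ℝ := fun z => (g z)⁻¹ with hfdef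
  set f1 : ℝ → ℝ := fun z => - deriv g z / g z ^ 2 with hf1def
  set f2 : ℝ → ℝ := fun z => - deriv (deriv g) z / g z ^ 2 + 2 * deriv g z ^ 2 / g z ^ 3 with hf2def
  have hf : ∀ z, HasDerivAt f (f1 z) z := fun z => (hgd z).inv (hgpos z).ne'
  have hf1 : ∀ z, HasDerivAt f1 (f2 z) z := by
    intro z
    have hz := (hgpos z).ne'
    have := (hgdd z).neg.div ((hgd z).pow 2) (pow_ne_zero 2 hz)
    refine this.congr_deriv ?_
    simp only [hf2def, Pi.neg_apply, Pi.pow_apply]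
    field_simp
    ring
  have hderiv : deriv f = f1 := funext fun z => (hf z).deriv
  have hf2 : ∀ z, |f2 z| ≤ |deriv (deriv g) z| + 2 * |deriv g z| ^ 2 := by
    intro z
    have h2 : (1:ℝ) ≤ g z ^ 2 := one_le_pow₀ (hg1 z)
    have h3 : (1:ℝ) ≤ g z ^ 3 := one_le_pow₀ (hg1 z)
    refine (abs_add_le _ _).trans (add_le_add ?_ ?_)
    · rw [abs_div, abs_neg, abs_of_pos (by positivity : 0 < g z ^ 2)]
      exact div_le_self (abs_nonneg _) h2
    · rw [abs_div, abs_of_nonneg (by positivity : 0 ≤ 2 * deriv g z ^ 2), sq_abs,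
        abs_of_pos (by linarith : 0 < g z ^ 3)]
      exact div_le_self (by positivity) h3
  have hf01 : ∀ z, 0 < f z ∧ f z ≤ 1 := fun z =>
    ⟨inv_pos.2 (hgpos z), inv_le_one_of_one_le₀ (hg1 z)⟩
  have hfanti : ∀ a b, a ≤ b → f b ≤ f a := fun a b hab =>
    inv_anti₀ (hgpos a) (hgmono hab)
  have hfcont : Continuous f := by
    rw [continuous_iff_continuousAt]; exact fun z => (hf z).continuousAt
  have hgnn : ∀ z, 0 ≤ deriv g z := fun z => hgmono.deriv_nonneg
  -- the Lévy weight
  set w : ℝ → ℝ := fun y => min 1 (y ^ 2) with hwdef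
  have hw0 : ∀ y, 0 ≤ w y := fun y => le_min zero_le_one (sq_nonneg y)
  have hwint : Integrable w ν := by
    refine ⟨by fun_prop, ?_⟩
    rw [hasFiniteIntegral_iff_ofReal (Eventually.of_forall hw0)]
    exact hνlevy
  have hJ0 : 0 ≤ ∫ y, w y ∂ν := integral_nonneg hw0
  set J := ∫ y, w y ∂ν with hJ
  have hfin : ∀ c : ℝ, 1 ≤ c → ν (Iic (-c)) < ⊤ := by
    intro c hc
    refine lt_of_le_of_lt (measure_mono ?_) (hwint.measure_norm_ge_lt_top one_pos)
    intro y hy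
    have hy : y ≤ -c := hy
    have : (1:ℝ) ≤ y ^ 2 := by nlinarith
    simp only [mem_ofPred_eq, Real.norm_eq_abs, hwdef]
    rw [min_eq_left this]; simp
  rw [hderiv]
  set h : ℝ → ℝ → ℝ := fun x y =>
    f (x + σ x * y) - f x - f1 x * σ x * Set.indicator (Set.Icc (-1:ℝ) 1) id y with hhdef
  have hin : ∀ x y, |y| ≤ 1 → h x y = f (x + σ x * y) - f x - f1 x * (σ x * y) := by
    intro x y hy
    simp only [hhdef, indicator_of_mem (show y ∈ Icc (-1:ℝ) 1 from abs_le.1 hy), id]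
    ring
  have hout : ∀ x y, ¬ |y| ≤ 1 → h x y = f (x + σ x * y) - f x := by
    intro x y hy
    simp only [hhdef, indicator_of_notMem (show y ∉ Icc (-1:ℝ) 1 from fun H => hy (abs_le.2 H))]
    ring
  have hwin : ∀ y, |y| ≤ 1 → w y = y ^ 2 := fun y hy =>
    min_eq_right ((sq_le_one_iff_abs_le_one y).2 hy)
  have hwout : ∀ y, ¬ |y| ≤ 1 → w y = 1 := fun y hy =>
    min_eq_left (by
      by_contra H
      exact hy ((sq_le_one_iff_abs_le_one y).1 (not_le.1 H).le))
  have hσsq : ∀ x y, (σ x * y) ^ 2 ≤ M ^ 2 * y ^ 2 := by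
    intro x y
    rw [mul_pow]
    exact mul_le_mul_of_nonneg_right (pow_le_pow_left₀ (hσ0 x).le (hM x) 2) (sq_nonneg y)
  set D := K + 2 * K ^ 2 with hDdef
  have hD0 : 0 ≤ D := by positivity
  have hbound : ∀ x y, |h x y| ≤ (D * M ^ 2 + 1) * w y := by
    intro x y
    by_cases hy : |y| ≤ 1
    · rw [hin x y hy, hwin y hy]
      have := taylor_aux f f1 f2 hf hf1 x (σ x * y) D (fun z _ => (hf2 z).trans (by
        have h1 := (hK z).1
        have h2 := (hK z).2
        have := pow_le_pow_left₀ (abs_nonneg _) h1 2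
        linarith))
      have h3 := mul_le_mul_of_nonneg_left (hσsq x y) hD0
      nlinarith [sq_nonneg y]
    · rw [hout x y hy, hwout y hy, abs_le]
      have a1 := hf01 x
      have a2 := hf01 (x + σ x * y)
      have a3 : 0 ≤ D * M ^ 2 := by positivity
      constructor <;> linarith [a1.1, a1.2, a2.1, a2.2]
  have hint : ∀ x, Integrable (h x) ν := by
    intro x
    refine (hwint.const_mul (D * M ^ 2 + 1)).mono' ?_ (Eventually.of_forall (hbound x))
    have : Measurable (h x) := by
      refine Measurable.sub (by fun_prop) ?_
      exact (measurable_id.indicator measurableSet_Icc).const_mul _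
    exact this.aestronglyMeasurable
  -- tail of the negative part
  obtain ⟨r0, hr0⟩ : ∃ r0 : ℝ, ∀ r ≤ r0, (ν (Set.Iic r)).toReal * Real.log |r| ^ (m_c + 1) < 1 :=
    eventually_atBot.1 (hνneg.eventually_lt_const zero_lt_one)
  obtain ⟨X, hX⟩ : ∃ X : ℝ, X = 4 + 2 * x₁ + 2 * M + 4 * M ^ 2 + 2 * M * (Real.exp 1 + |r0|) :=
    ⟨_, rfl⟩
  have he : 1 ≤ Real.exp 1 := Real.one_le_exp zero_le_one
  have hq1 : 0 ≤ M ^ 2 := sq_nonneg M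
  have hq2 : 0 ≤ 2 * M * (Real.exp 1 + |r0|) := by positivity
  have hX4 : 4 ≤ X := by linarith
  have hXx : 2 * x₁ ≤ X := by linarith
  have hXM : 2 * M ≤ X := by linarith
  have hXM2 : 4 * M ^ 2 ≤ X := by linarith
  have hXr : 2 * M * (Real.exp 1 + |r0|) ≤ X := by linarith
  have hlogX : 0 < Real.log X := Real.log_pos (by linarith)
  refine ⟨μc + (12 * M ^ 2 + 2) * J + 4, μc * (X * K) + (D * M ^ 2 + 1) * J + 1, Real.log X,
    by positivity, by positivity, hlogX, fun x => ⟨hint x, ?_⟩⟩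
  change -(μc * x * f1 x) + ∫ y, h x y ∂ν ≤ _
  have hgx2 : 0 < g x ^ 2 := pow_pos (hgpos x) 2
  have hdrift : -(μc * x * f1 x) = μc * (x * deriv g x) / g x ^ 2 := by
    simp only [hf1def]; ring
  by_cases hx : g x ≤ Real.log X
  · rw [if_pos hx]
    have hxX : x ≤ X := by
      by_contra H
      push Not at H
      rw [hgtail x (by linarith)] at hx
      exact absurd hx (not_le.2 (Real.log_lt_log (by linarith) H))
    have h1 : -(μc * x * f1 x) ≤ μc * (X * K) := by
      rw [hdrift]
      have hle : x * deriv g x ≤ X * K :=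
        (mul_le_mul_of_nonneg_right hxX (hgnn x)).trans
          (mul_le_mul_of_nonneg_left ((le_abs_self _).trans (hK x).1) (by linarith))
      have hXK : 0 ≤ μc * (X * K) := by positivity
      rw [div_le_iff₀ hgx2]
      have : (1:ℝ) ≤ g x ^ 2 := one_le_pow₀ (hg1 x)
      nlinarith [mul_le_mul_of_nonneg_left hle hμc.le]
    have h2 : ∫ y, h x y ∂ν ≤ (D * M ^ 2 + 1) * J := by
      rw [hJ, ← integral_const_mul]
      exact integral_mono (hint x) (hwint.const_mul _) fun y => (le_abs_self _).trans (hbound x y)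
    have h3 : 0 ≤ (μc + (12 * M ^ 2 + 2) * J + 4) / g x ^ 2 := by positivity
    linarith
  · rw [if_neg hx]
    have hxX : X < x := by
      by_contra H
      push Not at H
      apply hx
      rw [← hgtail X (by linarith)]
      exact hgmono H
    have hx0 : 0 < x := by linarith
    have hgx : g x = Real.log x := hgtail x (by linarith)
    -- derivatives of g in the tail
    have hgt : ∀ z, x₁ < z → deriv g z = z⁻¹ := by
      intro z hz
      have : g =ᶠ[nhds z] Real.log := by
        filter_upwards [lt_mem_nhds hz] with u hu using hgtail u hu.le
      rw [this.deriv_eq, Real.deriv_log]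
    have hgt2 : ∀ z, x₁ < z → deriv (deriv g) z = -(z ^ 2)⁻¹ := by
      intro z hz
      have : deriv g =ᶠ[nhds z] fun u => u⁻¹ := by
        filter_upwards [lt_mem_nhds hz] with u hu using hgt u hu
      rw [this.deriv_eq, deriv_inv]
    have hd : -(μc * x * f1 x) = μc / g x ^ 2 := by
      rw [hdrift, hgt x (by linarith), mul_inv_cancel₀ hx0.ne', mul_one]
    have hlx : Real.log x ≤ x := (Real.log_le_sub_one_of_pos hx0).trans (by linarith)
    have hlx0 : 0 < Real.log x := Real.log_pos (by linarith)
    set c := x / (2 * M) with hc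
    have hce : Real.exp 1 + |r0| ≤ c := by
      rw [hc, le_div_iff₀ (by positivity)]; linarith
    have hc1 : 1 ≤ c := by linarith [abs_nonneg r0]
    -- pointwise bound
    have hpt : ∀ y, h x y ≤ (12 * M ^ 2 + 2) / g x ^ 2 * w y
        + (Iic (-c)).indicator (fun _ => (1:ℝ)) y := by
      intro y
      have hi0 : 0 ≤ (Iic (-c)).indicator (fun _ => (1:ℝ)) y :=
        indicator_nonneg (fun _ _ => zero_le_one) y
      by_cases hy : |y| ≤ 1
      · rw [hin x y hy, hwin y hy]
        have hsy : |σ x * y| ≤ x / 2 := by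
          rw [abs_mul, abs_of_pos (hσ0 x)]
          calc σ x * |y| ≤ M * 1 := mul_le_mul (hM x) hy (abs_nonneg y) hMpos.le
            _ ≤ x / 2 := by linarith
        have ht := taylor_aux f f1 f2 hf hf1 x (σ x * y) (12 / g x ^ 2) (fun z hz => by
          have hzx : x / 2 ≤ z := by
            have := abs_sub_left_of_mem_uIcc hz
            rw [add_sub_cancel_left] at this
            have := (abs_le.1 (this.trans hsy)).1
            linarith
          have hz0 : 0 < z := by linarith
          have e : |deriv (deriv g) z| + 2 * |deriv g z| ^ 2 = 3 / z ^ 2 := by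
            rw [hgt z (by linarith), hgt2 z (by linarith), abs_neg, abs_of_pos (by positivity),
              abs_of_pos (by positivity)]
            field_simp; norm_num
          refine (hf2 z).trans (e.le.trans ?_)
          rw [hgx, div_le_div_iff₀ (by positivity) (by positivity)]
          have := pow_le_pow_left₀ hlx0.le (hlx.trans (by linarith : x ≤ 2 * z)) 2
          nlinarith)
        have h3 := mul_le_mul_of_nonneg_left (hσsq x y) (by positivity : 0 ≤ 12 / g x ^ 2)
        have h4 : (12 * M ^ 2 + 2) / g x ^ 2 * y ^ 2
            = 12 / g x ^ 2 * (M ^ 2 * y ^ 2) + 2 / g x ^ 2 * y ^ 2 := by ring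
        have h5 : 0 ≤ 2 / g x ^ 2 * y ^ 2 := by positivity
        linarith [(abs_le.1 ht).2]
      · rw [hout x y hy, hwout y hy]
        have hpos : 0 ≤ (12 * M ^ 2 + 2) / g x ^ 2 * 1 := by positivity
        by_cases hyc : y ≤ -c
        · rw [indicator_of_mem (show y ∈ Iic (-c) from hyc)]
          linarith [(hf01 x).1, (hf01 (x + σ x * y)).2]
        · push Not at hyc
          have hxy : x / 2 ≤ x + σ x * y := by
            have hMc : M * c = x / 2 := by rw [hc]; field_simp
            by_cases hy0 : 0 ≤ y
            · have := mul_nonneg (hσ0 x).le hy0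
              linarith
            · push Not at hy0
              have h1 : M * y ≤ σ x * y := mul_le_mul_of_nonpos_right (hM x) hy0.le
              have h2 : M * (-c) ≤ M * y := mul_le_mul_of_nonneg_left hyc.le hMpos.le
              linarith
          have h1 := hfanti _ _ hxy
          have h2 : f (x / 2) - f x ≤ 2 / g x ^ 2 := by
            simp only [hfdef]
            rw [hgx, hgtail (x / 2) (by linarith)]
            exact inv_log_aux x (by linarith)
          have h4 : (12 * M ^ 2 + 2) / g x ^ 2 * 1
            = 12 * M ^ 2 / g x ^ 2 + 2 / g x ^ 2 := by ring
          have h5 : 0 ≤ 12 * M ^ 2 / g x ^ 2 := by positivity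
          linarith
    have hindint : Integrable ((Iic (-c)).indicator (fun _ => (1:ℝ))) ν :=
      (integrable_indicator_iff measurableSet_Iic).2 (integrableOn_const (hfin c hc1).ne)
    have hI : ∫ y, h x y ∂ν ≤ (12 * M ^ 2 + 2) / g x ^ 2 * J + (ν (Iic (-c))).toReal := by
      have := integral_mono (hint x) ((hwint.const_mul _).add hindint) hpt
      simp only [Pi.add_apply] at this
      rw [integral_add (hwint.const_mul _) hindint, integral_const_mul,
        integral_indicator_const _ measurableSet_Iic] at this
      simpa [Measure.real] using this
    have htail : (ν (Iic (-c))).toReal ≤ 4 / g x ^ 2 := by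
      have h1 := hr0 (-c) (by linarith [neg_abs_le r0, abs_nonneg r0])
      rw [abs_neg, abs_of_pos (by linarith : 0 < c)] at h1
      have hlc : 1 ≤ Real.log c := by
        rw [Real.le_log_iff_exp_le (by linarith)]; linarith [abs_nonneg r0]
      have h2 : Real.log c ^ (2:ℝ) ≤ Real.log c ^ (m_c + 1) :=
        Real.rpow_le_rpow_of_exponent_le hlc (by linarith)
      rw [Real.rpow_two] at h2
      have h3 : Real.log x ≤ 2 * Real.log c := by
        have : x ≤ c ^ 2 := by
          rw [hc, div_pow, le_div_iff₀ (by positivity), pow_two x]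
          exact mul_le_mul_of_nonneg_left (by rw [mul_pow]; linarith) hx0.le
        have := Real.log_le_log hx0 this
        rw [Real.log_pow] at this
        exact_mod_cast this
      have h4 := pow_le_pow_left₀ hlx0.le h3 2
      have hn : 0 ≤ (ν (Iic (-c))).toReal := ENNReal.toReal_nonneg
      have h5 := mul_le_mul_of_nonneg_left h2 hn
      have h6 := mul_le_mul_of_nonneg_left h4 hn
      rw [hgx, le_div_iff₀ (by positivity)]
      rw [mul_pow, mul_left_comm] at h6
      linarith
    rw [hd]
    have hfinal : (μc + (12 * M ^ 2 + 2) * J + 4) / g x ^ 2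
        = μc / g x ^ 2 + (12 * M ^ 2 + 2) / g x ^ 2 * J + 4 / g x ^ 2 := by ring
    rw [hfinal]
    linarith
end
end

section
/- For every k, b ∈ (0,∞), define h : (1,∞) → ℝ by h(x) := −k·log x + log( (1+b) + sin(k·x)/x ); the argument of the second logarithm is positive for x > 1, and h is differentiable on (1,∞). Then limsup_{x→+∞} x·h'(x) = −k·b/(1+b). -/
open Filter

noncomputable section

theorem aux_pos (k b : ℝ) (hb : 0 < b) (x : ℝ) (hx : 1 < x) :
    0 < (1 + b) + Real.sin (k * x) / x := by
  have h0 : 0 < x := by linarith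
  have h1 : -1 ≤ Real.sin (k * x) / x := by
    rw [le_div_iff₀ h0]
    linarith [Real.neg_one_le_sin (k * x)]
  linarith

theorem aux_deriv_s19 (k b : ℝ) (hb : 0 < b) (x : ℝ) (hx : 1 < x) :
    HasDerivAt (fun x : ℝ => -k * Real.log x + Real.log ((1 + b) + Real.sin (k * x) / x))
      (-k * x⁻¹ + ((Real.cos (k * x) * k * x - Real.sin (k * x) * 1) / x ^ 2) /
        ((1 + b) + Real.sin (k * x) / x)) x := by
  have h0 : x ≠ 0 := by linarith
  have hs : HasDerivAt (fun x : ℝ => Real.sin (k * x)) (Real.cos (k * x) * k) x := by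
    have := ((hasDerivAt_id x).const_mul k).sin
    simpa using this
  exact ((Real.hasDerivAt_log h0).const_mul (-k)).add
    (((hs.div (hasDerivAt_id x) h0).const_add (1 + b)).log (aux_pos k b hb x hx).ne')

theorem stmt_19 (k b : ℝ) (hk : 0 < k) (hb : 0 < b) :
    (∀ x : ℝ, 1 < x → 0 < (1 + b) + Real.sin (k * x) / x) ∧
    (∀ x : ℝ, 1 < x → DifferentiableAt ℝ
      (fun x : ℝ => -k * Real.log x + Real.log ((1 + b) + Real.sin (k * x) / x)) x) ∧
    Filter.limsup
      (fun x : ℝ => x * deriv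
        (fun x : ℝ => -k * Real.log x + Real.log ((1 + b) + Real.sin (k * x) / x)) x)
      Filter.atTop = -k * b / (1 + b) := by
  refine ⟨aux_pos k b hb, fun x hx => (aux_deriv_s19 k b hb x hx).differentiableAt, ?_⟩
  set f : ℝ → ℝ := fun x : ℝ => x * deriv
        (fun x : ℝ => -k * Real.log x + Real.log ((1 + b) + Real.sin (k * x) / x)) x with hf
  have hfe : ∀ x, 1 < x → f x = -k + (k * Real.cos (k * x) - Real.sin (k * x) / x) /
      ((1 + b) + Real.sin (k * x) / x) := by
    intro x hx
    have h0 : x ≠ 0 := by linarith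
    have hp := (aux_pos k b hb x hx).ne'
    simp only [hf]
    rw [(aux_deriv_s19 k b hb x hx).deriv, mul_add, ← mul_div_assoc]
    congr 1
    · field_simp
    · congr 1
      field_simp
  have hU : ∀ x, 1 < x → f x ≤ -k + (k + x⁻¹) / ((1 + b) - x⁻¹) := by
    intro x hx
    rw [hfe x hx]
    have h0 : 0 < x := by linarith
    have hi : x⁻¹ < 1 := inv_lt_one_of_one_lt₀ hx
    have hi0 : 0 < x⁻¹ := inv_pos.2 h0
    have h1 : -x⁻¹ ≤ Real.sin (k * x) / x := by
      rw [div_eq_mul_inv]; nlinarith [Real.neg_one_le_sin (k * x)]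
    have h2 : k * Real.cos (k * x) ≤ k := by nlinarith [Real.cos_le_one (k * x)]
    have : (k * Real.cos (k * x) - Real.sin (k * x) / x) / ((1 + b) + Real.sin (k * x) / x)
        ≤ (k + x⁻¹) / ((1 + b) - x⁻¹) := by
      apply div_le_div₀ <;> linarith
    linarith
  have hT : Tendsto (fun x : ℝ => -k + (k + x⁻¹) / ((1 + b) - x⁻¹)) atTop
      (nhds (-k * b / (1 + b))) := by
    have hz := tendsto_inv_atTop_zero (𝕜 := ℝ)
    have hb1 : (1 + b) - 0 ≠ 0 := by linarith
    have := ((hz.const_add k).div (hz.const_sub (1 + b)) hb1).const_add (-k)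
    have he : -k * b / (1 + b) = -k + (k + 0) / ((1 + b) - 0) := by
      rw [add_zero, sub_zero]
      field_simp
      ring
    rw [he]
    exact this
  have hle : f ≤ᶠ[atTop] (fun x : ℝ => -k + (k + x⁻¹) / ((1 + b) - x⁻¹)) := by
    filter_upwards [eventually_gt_atTop 1] with x hx using hU x hx
  have hfr : ∃ᶠ x in atTop, -k * b / (1 + b) ≤ f x := by
    have ht : Tendsto (fun n : ℕ => (n : ℝ) * (2 * Real.pi / k)) atTop atTop :=
      tendsto_natCast_atTop_atTop.atTop_mul_const (by positivity)
    refine ht.frequently (Eventually.frequently ?_)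
    filter_upwards [ht.eventually_gt_atTop 1] with n hn
    rw [hfe _ hn]
    have e : k * ((n : ℝ) * (2 * Real.pi / k)) = n * (2 * Real.pi) := by field_simp
    have es : Real.sin (n * (2 * Real.pi)) = 0 := by
      simpa using Real.sin_add_nat_mul_two_pi 0 n
    rw [e, Real.cos_nat_mul_two_pi, es]
    apply le_of_eq
    simp only [zero_div, add_zero, sub_zero, mul_one]
    field_simp
    ring
  apply le_antisymm
  · rw [← hT.limsup_eq]
    exact limsup_le_limsup hle (IsCoboundedUnder.of_frequently_ge hfr) hT.isBoundedUnder_le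
  · exact le_limsup_of_frequently_le hfr (hT.isBoundedUnder_le.mono_le hle)
end
end
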